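/- If 𝔯 < 𝔠, then there exists a subgroup G ⊆ S_ω of cardinality 𝔯, generated by involutions with pairwise almost disjoint supports, such that in the finitary coarse space (ω, E_G), ω cannot be covered by finitely many thin sets. -/

import Mathlib

open Cardinal

/-- The reaping number `𝔯`: the smallest cardinality of a family `R` of
infinite subsets of `ω` such that for every finite partition of `ω` one of
the cells contains a member of `R`. -/
noncomputable def reapingNumber : Cardinal :=
  sInf { c : Cardinal | ∃ R : Set (Set ℕ), #R = c ∧ (∀ r ∈ R, r.Infinite) ∧
    ∀ (n : ℕ) (P : Fin n → Set ℕ), (⋃ i, P i) = Set.univ →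
      Pairwise (Function.onFun Disjoint P) → ∃ i, ∃ r ∈ R, r ⊆ P i }

/-- `T ⊆ ω` is thin (1-thin) in the finitary coarse space `(ω, E_G)`:
for every finite `F ⊆ G` all but finitely many `x ∈ T` satisfy
`T ∩ F x = {x}`. -/
def IsEGThin (G : Subgroup (Equiv.Perm ℕ)) (T : Set ℕ) : Prop :=
  ∀ F : Finset (Equiv.Perm ℕ), (↑F : Set (Equiv.Perm ℕ)) ⊆ (G : Set (Equiv.Perm ℕ)) →
    {x ∈ T | ∃ g ∈ F, g x ∈ T ∧ g x ≠ x}.Finite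

/-- A family of sets indexed by `ι`, each of size larger than `#ι`, has an injective choice
function. -/
theorem exists_injective_mem_of_mk_lt {ι X : Type} (C : ι → Set X) (hC : ∀ i, #ι < #(C i)) :
    ∃ f : ι → X, Function.Injective f ∧ ∀ i, f i ∈ C i := by
  classical
  have hne : ∀ i (p : ∀ j, WellOrderingRel j i → X),
      ∃ x ∈ C i, ∀ j h, p j h ≠ x := by
    intro i p
    by_contra! hcon
    have hsub : C i ⊆ Set.range (fun j : {j // WellOrderingRel j i} => p j.1 j.2) := by
      intro x hx
      obtain ⟨j, h, hj⟩ := hcon x hx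
      exact ⟨⟨j, h⟩, hj⟩
    exact ((mk_le_mk_of_subset hsub).trans (mk_range_le.trans (mk_subtype_le _))).not_gt (hC i)
  choose g hg hg' using hne
  have wf : WellFounded (WellOrderingRel (α := ι)) := IsWellFounded.wf
  let f : ι → X := wf.fix g
  have hf : ∀ i, f i = g i fun j _ => f j := fun i => wf.fix_eq g i
  have hlt : ∀ i j, WellOrderingRel j i → f j ≠ f i := by
    intro i j h
    rw [hf i]
    exact hg' i (fun j _ => f j) j h
  refine ⟨f, fun i j hij => ?_, fun i => hf i ▸ hg i _⟩
  rcases trichotomous_of WellOrderingRel i j with h | h | h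
  · exact absurd hij (hlt j i h)
  · exact h
  · exact absurd hij.symm (hlt i j h)

/-- Every infinite set of natural numbers carries an almost disjoint family of size continuum. -/
theorem exists_almostDisjoint_subsets {r : Set ℕ} (hr : r.Infinite) :
    ∃ A : (ℕ → Bool) → Set ℕ, (∀ x, A x ⊆ r ∧ (A x).Infinite) ∧
      Pairwise fun x y => (A x ∩ A y).Finite := by
  let e : ℕ ↪ r := hr.natEmbedding
  let p : (ℕ → Bool) → ℕ → ℕ := fun x n => e (Encodable.encode ((List.range n).map x))
  have hp : ∀ x y m n, p x m = p y n → (List.range m).map x = (List.range n).map y :=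
    fun x y m n h => Encodable.encode_injective (e.injective (Subtype.ext h))
  have hlen : ∀ x y m n, p x m = p y n → m = n := fun x y m n h => by
    simpa using congrArg List.length (hp x y m n h)
  refine ⟨fun x => Set.range (p x), fun x => ⟨?_, ?_⟩, fun x y hxy => ?_⟩
  · rintro _ ⟨n, rfl⟩
    exact (e _).2
  · exact Set.infinite_range_of_injective fun m n h => hlen x x m n h
  · obtain ⟨k, hk⟩ := Function.ne_iff.mp hxy
    refine ((Set.finite_le_nat k).image (p x)).subset ?_
    rintro _ ⟨⟨m, rfl⟩, n, hn⟩
    refine ⟨m, ?_, rfl⟩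
    obtain rfl := hlen _ _ _ _ hn
    by_contra hkm
    exact hk (List.map_inj_left.mp (hp _ _ _ _ hn) k
      (List.mem_range.mpr (not_le.mp hkm))).symm

/-- Fewer than continuum many infinite sets of natural numbers have an almost disjoint
refinement. -/
theorem exists_almostDisjoint_refinement {ι : Type} [Infinite ι] (hι : #ι < continuum)
    (r : ι → Set ℕ) (hr : ∀ i, (r i).Infinite) :
    ∃ B : ι → Set ℕ, (∀ i, B i ⊆ r i ∧ (B i).Infinite) ∧
      Pairwise fun i j => (B i ∩ B j).Finite := by
  have hinf : ℵ₀ ≤ #ι := aleph0_le_mk ι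
  choose A hA hAd using fun i => exists_almostDisjoint_subsets (hr i)
  let M : ι → ι → Set (ℕ → Bool) := fun a b => {x | (r b ∩ A a x).Infinite}
  have hself : ∀ b, #ι < #(M b b) := by
    intro b
    have : M b b = Set.univ := Set.eq_univ_of_forall fun x => by
      change (r b ∩ A b x).Infinite
      rw [Set.inter_eq_right.mpr (hA b x).1]
      exact (hA b x).2
    rw [this, mk_univ]
    simpa using hι
  have wf : WellFounded (WellOrderingRel (α := ι)) := IsWellFounded.wf
  have hφ : ∀ b, ∃ a, #ι < #(M a b) ∧ ∀ c, WellOrderingRel c a → #(M c b) ≤ #ι := by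
    intro b
    obtain ⟨a, ha, hmin⟩ := wf.has_min {a | #ι < #(M a b)} ⟨b, hself b⟩
    exact ⟨a, ha, fun c hc => not_lt.mp fun h => hmin c h hc⟩
  choose φ hφbig hφmin using hφ
  let D : ι → Set (ℕ → Bool) := fun a => ⋃ b : {b // WellOrderingRel a (φ b)}, M a b
  have hD : ∀ a, #(D a) ≤ #ι := by
    intro a
    have hsup : ⨆ b : {b // WellOrderingRel a (φ b)}, #(M a b) ≤ #ι :=
      ciSup_le' fun b => hφmin b.1 a b.2
    have hsub : #{b // WellOrderingRel a (φ b)} ≤ #ι := mk_subtype_le _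
    exact (mk_iUnion_le _).trans (mul_le_of_le hinf hsub hsup)
  have hC : ∀ b, #ι < #(M (φ b) b \ D (φ b) : Set (ℕ → Bool)) := by
    intro b
    by_contra! hle
    have hsub : M (φ b) b ⊆ (M (φ b) b \ D (φ b)) ∪ D (φ b) := by
      rw [Set.sdiff_union_self]
      exact Set.subset_union_left
    refine (hφbig b).not_ge ?_
    refine ((mk_le_mk_of_subset hsub).trans (mk_union_le _ _)).trans ?_
    exact add_le_of_le hinf hle (hD _)
  obtain ⟨f, hf, hfC⟩ := exists_injective_mem_of_mk_lt _ hC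
  have hlt : ∀ i j, WellOrderingRel (φ i) (φ j) →
      ((r i ∩ A (φ i) (f i)) ∩ (r j ∩ A (φ j) (f j))).Finite := by
    intro i j h
    have : ¬ (r j ∩ A (φ i) (f i)).Infinite := fun h' =>
      (hfC i).2 (Set.mem_iUnion.mpr ⟨⟨j, h⟩, h'⟩)
    exact (Set.not_infinite.mp this).subset fun x hx => ⟨hx.2.1, hx.1.2⟩
  refine ⟨fun i => r i ∩ A (φ i) (f i), fun i => ⟨Set.inter_subset_left, (hfC i).1⟩,
    fun i j hij => ?_⟩
  rcases trichotomous_of WellOrderingRel (φ i) (φ j) with h | h | h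
  · exact hlt i j h
  · refine (hAd (φ i) (hf.ne hij)).subset fun x hx => ⟨hx.1.2, ?_⟩
    rw [h]
    exact hx.2.2
  · exact (hlt j i h).subset fun x hx => ⟨hx.2, hx.1⟩

/-- Every infinite set of natural numbers is the support of an involution. -/
theorem exists_involution_support_eq {B : Set ℕ} (hB : B.Infinite) :
    ∃ f : Equiv.Perm ℕ, f * f = 1 ∧ {x | f x ≠ x} = B := by
  classical
  have := hB.to_subtype
  obtain ⟨e⟩ : Nonempty (B ≃ ℕ × Bool) := nonempty_equiv_of_countable
  let p : Equiv.Perm B := e.trans (((Equiv.refl ℕ).prodCongr Equiv.boolNot).trans e.symm)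
  have hp : p * p = 1 := by
    ext x
    have h (y : ℕ × Bool) : Prod.map id Equiv.boolNot (Prod.map id Equiv.boolNot y) = y := by
      simp [Prod.map]
    simp [p, h]
  have hne : ∀ x, p x ≠ x := by
    intro x h
    have h' := congrArg (fun y => (e y).2) h
    simp [p] at h'
  refine ⟨Equiv.Perm.ofSubtype p, by rw [← map_mul, hp, map_one], ?_⟩
  ext x
  by_cases hx : x ∈ B
  · have : ((p ⟨x, hx⟩ : B) : ℕ) ≠ x := fun h => hne ⟨x, hx⟩ (Subtype.ext h)
    simpa [Equiv.Perm.ofSubtype_apply_of_mem p hx, hx] using this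
  · simp [Equiv.Perm.ofSubtype_apply_of_not_mem p hx, hx]

/-- The reaping number is attained. -/
theorem exists_reaping_family : ∃ R : Set (Set ℕ), #R = reapingNumber ∧
    (∀ r ∈ R, r.Infinite) ∧
    ∀ (n : ℕ) (P : Fin n → Set ℕ), (⋃ i, P i) = Set.univ →
      Pairwise (Function.onFun Disjoint P) → ∃ i, ∃ r ∈ R, r ⊆ P i := by
  refine csInf_mem (s := { c : Cardinal | ∃ R : Set (Set ℕ), #R = c ∧ (∀ r ∈ R, r.Infinite) ∧
    ∀ (n : ℕ) (P : Fin n → Set ℕ), (⋃ i, P i) = Set.univ →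
      Pairwise (Function.onFun Disjoint P) → ∃ i, ∃ r ∈ R, r ⊆ P i })
    ⟨_, {r | r.Infinite}, rfl, fun _ h => h, fun n P hP _ => ?_⟩
  by_contra! hcon
  refine Set.infinite_univ (α := ℕ) (hP ▸ Set.finite_iUnion fun i => ?_)
  exact Set.not_infinite.mp fun h => hcon i _ h subset_rfl

/-- A reaping family is infinite. -/
theorem infinite_of_reaping {R : Set (Set ℕ)} (hR : ∀ r ∈ R, r.Infinite)
    (hreap : ∀ (n : ℕ) (P : Fin n → Set ℕ), (⋃ i, P i) = Set.univ →
      Pairwise (Function.onFun Disjoint P) → ∃ i, ∃ r ∈ R, r ⊆ P i) : R.Infinite := by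
  intro hfin
  obtain ⟨N, hN⟩ := (hfin.image sInf).bddAbove
  have hmem : ∀ r ∈ R, ∃ x ∈ r, x ≤ N := fun r hr =>
    ⟨sInf r, Nat.sInf_mem (hR r hr).nonempty, hN ⟨r, hr, rfl⟩⟩
  obtain ⟨i, r, hr, hsub⟩ := hreap 2 ![Set.Iic N, Set.Ioi N]
    (by
      refine Set.eq_univ_of_forall fun x => Set.mem_iUnion.mpr ?_
      rcases le_or_gt x N with h | h
      · exact ⟨0, h⟩
      · exact ⟨1, h⟩)
    (by
      have h : Disjoint (Set.Iic N) (Set.Ioi N) := Set.Iic_disjoint_Ioi le_rfl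
      intro i j hij
      fin_cases i <;> fin_cases j <;> simp_all [Function.onFun, disjoint_comm])
  fin_cases i
  · exact hR r hr ((Set.finite_Iic N).subset hsub)
  · obtain ⟨x, hx, hxN⟩ := hmem r hr
    exact (hsub hx).not_ge hxN

theorem exists_group_not_coverable_by_thin (hr : reapingNumber < Cardinal.continuum) :
    ∃ G : Subgroup (Equiv.Perm ℕ), #G = reapingNumber ∧
      (∃ S : Set (Equiv.Perm ℕ), G = Subgroup.closure S ∧
        (∀ f ∈ S, f * f = 1) ∧
        (∀ f ∈ S, ∀ g ∈ S, f ≠ g → ({x | f x ≠ x} ∩ {x | g x ≠ x}).Finite)) ∧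
      ¬ ∃ (n : ℕ) (T : Fin n → Set ℕ),
          (∀ i, IsEGThin G (T i)) ∧ (⋃ i, T i) = Set.univ := by
  obtain ⟨R, hRcard, hRinf, hreap⟩ := exists_reaping_family
  have hR := (infinite_of_reaping hRinf hreap).to_subtype
  obtain ⟨B, hB, hBd⟩ := exists_almostDisjoint_refinement (hRcard ▸ hr)
    (fun r : R => (r : Set ℕ)) fun r => hRinf r r.2
  choose f hf hsupp using fun r => exists_involution_support_eq (hB r).2
  have hinj : Function.Injective f := by
    intro r s h
    by_contra hrs
    have hEq : B r = B s := by rw [← hsupp r, ← hsupp s, h]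
    refine (hB r).2 ?_
    simpa [← hEq] using hBd hrs
  have hScard : #(Set.range f) = #R := mk_range_eq f hinj
  have hSinf : ℵ₀ ≤ #(Set.range f) := hScard ▸ aleph0_le_mk R
  refine ⟨Subgroup.closure (Set.range f), ?_, ⟨Set.range f, rfl, ?_, ?_⟩, ?_⟩
  · rw [← hRcard, ← hScard]
    refine le_antisymm ?_ (mk_le_mk_of_subset Subgroup.subset_closure)
    have := infinite_iff.mpr hSinf
    have hcl : Subgroup.closure (Set.range f) =
        (FreeGroup.lift ((↑) : Set.range f → Equiv.Perm ℕ)).range := by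
      rw [FreeGroup.range_lift_eq_closure, Subtype.range_coe]
    rw [hcl]
    refine (mk_range_le (f := FreeGroup.lift ((↑) : Set.range f → Equiv.Perm ℕ))).trans ?_
    exact ((mk_freeGroup _).trans (max_eq_left hSinf)).le
  · rintro _ ⟨r, rfl⟩
    exact hf r
  · rintro _ ⟨r, rfl⟩ _ ⟨s, rfl⟩ hrs
    rw [hsupp, hsupp]
    exact hBd fun h => hrs (congrArg f h)
  · rintro ⟨n, T, hT, hcov⟩
    obtain ⟨i, r, hrR, hsub⟩ := hreap n (fun i => {x | x ∈ T i ∧ ∀ j < i, x ∉ T j})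
      (by
        refine Set.eq_univ_of_forall fun x => Set.mem_iUnion.mpr ?_
        have hx : ∃ i, x ∈ T i := Set.mem_iUnion.mp (hcov ▸ Set.mem_univ x)
        obtain ⟨i, hi, hmin⟩ := wellFounded_lt.has_min {i | x ∈ T i} hx
        exact ⟨i, hi, fun j hj hxj => hmin j hxj hj⟩)
      (by
        intro i j hij
        refine Set.disjoint_left.mpr fun x hi hj => ?_
        rcases hij.lt_or_gt with h | h
        · exact hj.2 i h hi.1
        · exact hi.2 j h hj.1)
    have hBT : B ⟨r, hrR⟩ ⊆ T i := fun x hx => (hsub ((hB ⟨r, hrR⟩).1 hx)).1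
    refine (hB ⟨r, hrR⟩).2 ((hT i {f ⟨r, hrR⟩} ?_).subset fun x hx => ?_)
    · simpa using Subgroup.subset_closure (Set.mem_range_self (f := f) ⟨r, hrR⟩)
    · have hmove : f ⟨r, hrR⟩ x ≠ x := by
        rwa [← hsupp ⟨r, hrR⟩] at hx
      have himage : f ⟨r, hrR⟩ x ∈ B ⟨r, hrR⟩ := by
        rw [← hsupp ⟨r, hrR⟩]
        exact fun h => hmove ((f ⟨r, hrR⟩).injective h)
      exact ⟨hBT hx, _, Finset.mem_singleton_self _, hBT himage, hmove⟩
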